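/- arXiv:1702.05227 — 4 statements merged into one kernel-verified Lean document; each statement's English description precedes it below -/
import Mathlib

section
/- Let M be the 4×3 matrix over ℂ[x,y,z] given by M = [[z, 2y, x], [5x⁴+y², z+2xy, y], [6x⁵, 3y², 2z], [7x⁶+4x³z+z², 2yz, x⁴+2xz+y²]] (the Jacobian matrix of f₁), and let I ⊆ ℂ[x,y,z] be the ideal generated by all 3×3 minors of M. Then the Krull dimension of the quotient ring ℂ[x,y,z]/I equals 1; in particular the ramification locus of f₁ has codimension 2 in ℂ³. -/
open MvPolynomial

/-- The Jacobian matrix of `f₁`, a `4×3` matrix over `ℂ[x,y,z]`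
(with `x = X 0`, `y = X 1`, `z = X 2`). -/
noncomputable def M : Matrix (Fin 4) (Fin 3) (MvPolynomial (Fin 3) ℂ) :=
  Matrix.of
    ![![X 2, 2 * X 1, X 0],
      ![5 * X 0 ^ 4 + X 1 ^ 2, X 2 + 2 * X 0 * X 1, X 1],
      ![6 * X 0 ^ 5, 3 * X 1 ^ 2, 2 * X 2],
      ![7 * X 0 ^ 6 + 4 * X 0 ^ 3 * X 2 + X 2 ^ 2, 2 * X 1 * X 2,
        X 0 ^ 4 + 2 * X 0 * X 2 + X 1 ^ 2]]

/-- The ideal of `ℂ[x,y,z]` generated by all `3×3` minors of `M`. -/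
noncomputable def I : Ideal (MvPolynomial (Fin 3) ℂ) :=
  Ideal.span { p | ∃ r : Fin 3 → Fin 4, Function.Injective r ∧
    p = (M.submatrix r id).det }

/-- If `y ^ p` and `z ^ q` are `R`-linear combinations of monomials in `y`, `z` of smaller weight,
then every monomial in `y`, `z` is an `R`-linear combination of those with exponents bounded
by `p` and `q`. -/
lemma pow_mul_pow_mem_span_of_weight_lt {R A : Type*} [CommRing R] [CommRing A] [Algebra R A]
    (y z : A) (u v p q : ℕ)
    (hy : y ^ p ∈ Submodule.span R {a | ∃ b c, u * b + v * c < u * p ∧ a = y ^ b * z ^ c})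
    (hz : z ^ q ∈ Submodule.span R {a | ∃ b c, u * b + v * c < v * q ∧ a = y ^ b * z ^ c})
    (b c : ℕ) :
    y ^ b * z ^ c ∈
      Submodule.span R (Set.range fun i : Fin p × Fin q => y ^ (i.1 : ℕ) * z ^ (i.2 : ℕ)) := by
  induction hn : u * b + v * c using Nat.strong_induction_on generalizing b c with
  | _ n ih =>
    have reduce (w : A) (m b₀ c₀ : ℕ) (hm : m + (u * b₀ + v * c₀) = n)
        (hw : w ∈ Submodule.span R {a | ∃ b c, u * b + v * c < m ∧ a = y ^ b * z ^ c}) :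
        w * (y ^ b₀ * z ^ c₀) ∈
          Submodule.span R (Set.range fun i : Fin p × Fin q => y ^ (i.1 : ℕ) * z ^ (i.2 : ℕ)) := by
      induction hw using Submodule.span_induction with
      | mem a ha =>
        obtain ⟨b', c', hlt, rfl⟩ := ha
        have h := ih (u * (b' + b₀) + v * (c' + c₀)) (by linarith) (b' + b₀) (c' + c₀) rfl
        convert h using 1
        ring
      | zero => simp
      | add a a' _ _ h h' => rw [add_mul]; exact add_mem h h'
      | smul r a _ h => rw [smul_mul_assoc]; exact Submodule.smul_mem _ r h
    by_cases hb : b < p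
    · by_cases hc : c < q
      · exact Submodule.subset_span ⟨(⟨b, hb⟩, ⟨c, hc⟩), rfl⟩
      · obtain ⟨c, rfl⟩ := Nat.exists_eq_add_of_le (not_lt.1 hc)
        convert reduce (z ^ q) (v * q) b c (by rw [← hn]; ring) hz using 1
        ring
    · obtain ⟨b, rfl⟩ := Nat.exists_eq_add_of_le (not_lt.1 hb)
      convert reduce (y ^ p) (u * p) b c (by rw [← hn]; ring) hy using 1
      ring

lemma ringKrullDim_le_of_isIntegral (R A : Type*) [CommRing R] [CommRing A] [Algebra R A]
    [Algebra.IsIntegral R A] : ringKrullDim A ≤ ringKrullDim R := by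
  refine Order.krullDim_le_of_strictMono (PrimeSpectrum.comap (algebraMap R A)) fun p q h => ?_
  exact Ideal.IsIntegral.comap_lt_comap h

lemma minor_mem_I (r : Fin 3 → Fin 4) (hr : Function.Injective r) : (M.submatrix r id).det ∈ I :=
  Ideal.subset_span ⟨r, hr, rfl⟩

/-- The `x`-axis lies in the ramification locus. -/
lemma I_le_ker_aeval_X_axis :
    I ≤ RingHom.ker (aeval ![Polynomial.X, 0, 0] : MvPolynomial (Fin 3) ℂ →ₐ[ℂ] Polynomial ℂ) := by
  refine Ideal.span_le.2 ?_
  rintro _ ⟨r, -, rfl⟩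
  rw [SetLike.mem_coe, RingHom.mem_ker, AlgHom.map_det]
  refine Matrix.det_eq_zero_of_column_eq_zero 1 fun i => ?_
  generalize hk : r i = k
  fin_cases k <;> simp [M, hk]

lemma one_le_ringKrullDim_quotient_I : 1 ≤ ringKrullDim (MvPolynomial (Fin 3) ℂ ⧸ I) := by
  rw [← IsPrincipalIdealRing.ringKrullDim_eq_one (Polynomial ℂ) (Polynomial.not_isField ℂ)]
  refine ringKrullDim_le_of_surjective (Ideal.Quotient.lift I _ I_le_ker_aeval_X_axis) ?_
  refine Ideal.Quotient.lift_surjective_of_surjective _ _ fun f => ⟨Polynomial.aeval (X 0) f, ?_⟩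
  change aeval _ (Polynomial.aeval (X 0) f) = f
  rw [← Polynomial.aeval_algHom_apply]
  simp

/-- Modulo the minors, `y ^ 7` and `z ^ 5` are combinations of monomials divisible by `x`. -/
lemma six_mul_pow_eq (x y z : MvPolynomial (Fin 3) ℂ ⧸ I) (hx : x = Ideal.Quotient.mk I (X 0))
    (hy : y = Ideal.Quotient.mk I (X 1)) (hz : z = Ideal.Quotient.mk I (X 2)) :
    6 * y ^ 7 =
        6 * (x ^ 2 * (y ^ 3 * z ^ 2)) + (-16) * (x ^ 3 * (y ^ 1 * z ^ 3)) +
        24 * (x ^ 3 * (y ^ 4 * z ^ 1)) + (-36) * (x ^ 4 * (y ^ 5 * z ^ 0)) +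
        (-36) * (x ^ 5 * (y ^ 3 * z ^ 1)) + (-16) * (x ^ 6 * (y ^ 1 * z ^ 2)) +
        42 * (x ^ 6 * (y ^ 4 * z ^ 0)) + (-72) * (x ^ 8 * (y ^ 3 * z ^ 0)) +
        12 * (x ^ 9 * (y ^ 1 * z ^ 1)) ∧
      6 * z ^ 5 =
        (-33) * (x ^ 1 * (y ^ 1 * z ^ 4)) + (-51) * (x ^ 1 * (y ^ 4 * z ^ 2)) +
        (-42) * (x ^ 2 * (y ^ 2 * z ^ 3)) + (-392) * (x ^ 3 * (y ^ 3 * z ^ 2)) +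
        123 * (x ^ 4 * (y ^ 1 * z ^ 3)) + 378 * (x ^ 4 * (y ^ 4 * z ^ 1)) +
        255 * (x ^ 5 * (y ^ 2 * z ^ 2)) + 168 * (x ^ 5 * (y ^ 5 * z ^ 0)) +
        18 * (x ^ 6 * (y ^ 0 * z ^ 3)) + (-518) * (x ^ 6 * (y ^ 3 * z ^ 1)) +
        183 * (x ^ 7 * (y ^ 1 * z ^ 2)) + 294 * (x ^ 7 * (y ^ 4 * z ^ 0)) +
        504 * (x ^ 8 * (y ^ 2 * z ^ 1)) + 168 * (x ^ 9 * (y ^ 3 * z ^ 0)) := by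
  have key (r : Fin 3 → Fin 4) (hr : Function.Injective r) :
      Ideal.Quotient.mk I (M.submatrix r id).det = 0 :=
    Ideal.Quotient.eq_zero_iff_mem.2 (minor_mem_I r hr)
  have h₁ := key ![0, 1, 2] (by decide)
  have h₂ := key ![0, 1, 3] (by decide)
  have h₃ := key ![0, 2, 3] (by decide)
  rw [Matrix.det_fin_three] at h₁ h₂ h₃
  simp [M, map_ofNat (Ideal.Quotient.mk I), ← hx, ← hy, ← hz] at h₁ h₂ h₃
  constructor
  · linear_combination z * h₃ - 3 * y ^ 2 * h₂
  · linear_combination 3 * z ^ 2 * h₁ + 21 * y * z * h₂ + 14 * y ^ 2 * h₃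

lemma ringKrullDim_quotient_I_le_one : ringKrullDim (MvPolynomial (Fin 3) ℂ ⧸ I) ≤ 1 := by
  let φ : Polynomial ℂ →ₐ[ℂ] MvPolynomial (Fin 3) ℂ ⧸ I :=
    Polynomial.aeval (Ideal.Quotient.mk I (X 0))
  let _ : Algebra (Polynomial ℂ) (MvPolynomial (Fin 3) ℂ ⧸ I) := φ.toRingHom.toAlgebra
  obtain ⟨x, hx⟩ : ∃ x, x = Ideal.Quotient.mk I (X 0) := ⟨_, rfl⟩
  obtain ⟨y, hy⟩ : ∃ y, y = Ideal.Quotient.mk I (X 1) := ⟨_, rfl⟩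
  obtain ⟨z, hz⟩ : ∃ z, z = Ideal.Quotient.mk I (X 2) := ⟨_, rfl⟩
  have smul_def (f : Polynomial ℂ) (a : MvPolynomial (Fin 3) ℂ ⧸ I) : f • a = φ f * a := rfl
  have φX : φ Polynomial.X = x := by simp [φ, hx]
  obtain ⟨hy7, hz5⟩ := six_mul_pow_eq x y z hx hy hz
  have of_six_mul (N : Submodule (Polynomial ℂ) (MvPolynomial (Fin 3) ℂ ⧸ I))
      (a : MvPolynomial (Fin 3) ℂ ⧸ I) (h : 6 * a ∈ N) : a ∈ N := by
    convert N.smul_mem (Polynomial.C (6⁻¹ : ℂ)) h using 1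
    rw [smul_def, ← map_ofNat φ 6, ← mul_assoc, ← map_mul, ← map_ofNat Polynomial.C 6, ← map_mul]
    simp
  have term_mem {m : ℕ} (k : ℤ) (a b c : ℕ) (h : 2 * b + 3 * c < m) :
      (k : MvPolynomial (Fin 3) ℂ ⧸ I) * (x ^ a * (y ^ b * z ^ c)) ∈
        Submodule.span (Polynomial ℂ)
          {a | ∃ b c, 2 * b + 3 * c < m ∧ a = y ^ b * z ^ c} := by
    have := Submodule.smul_mem _ ((k : Polynomial ℂ) * Polynomial.X ^ a)
      (Submodule.subset_span (R := Polynomial ℂ)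
        (show y ^ b * z ^ c ∈ {a | ∃ b c, 2 * b + 3 * c < m ∧ a = y ^ b * z ^ c} from
          ⟨b, c, h, rfl⟩))
    rwa [smul_def, map_mul, map_pow, map_intCast, φX, mul_assoc] at this
  have hmon := pow_mul_pow_mem_span_of_weight_lt (R := Polynomial ℂ) y z 2 3 7 5
    (of_six_mul _ _ (by
      rw [hy7]
      repeat' apply add_mem
      all_goals exact mod_cast term_mem _ _ _ _ (by norm_num)))
    (of_six_mul _ _ (by
      rw [hz5]
      repeat' apply add_mem
      all_goals exact mod_cast term_mem _ _ _ _ (by norm_num)))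
  have hfin : Module.Finite (Polynomial ℂ) (MvPolynomial (Fin 3) ℂ ⧸ I) := by
    refine ⟨Submodule.fg_def.2 ⟨Set.range fun i : Fin 7 × Fin 5 => y ^ (i.1 : ℕ) * z ^ (i.2 : ℕ),
      Set.finite_range _, eq_top_iff.2 fun a _ => ?_⟩⟩
    obtain ⟨f, rfl⟩ := Ideal.Quotient.mk_surjective a
    induction f using MvPolynomial.induction_on' with
    | monomial s c =>
      have h := Submodule.smul_mem _ (Polynomial.C c * Polynomial.X ^ s 0) (hmon (s 1) (s 2))
      convert h using 1
      rw [smul_def, map_mul, map_pow, φX, hx, hy, hz, monomial_eq,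
        Finsupp.prod_fintype _ _ (by simp)]
      simp [Fin.prod_univ_three, φ, mul_assoc]
      rfl
    | add f g hf hg => rw [map_add]; exact add_mem (hf trivial) (hg trivial)
  rw [← IsPrincipalIdealRing.ringKrullDim_eq_one (Polynomial ℂ) (Polynomial.not_isField ℂ)]
  exact ringKrullDim_le_of_isIntegral (Polynomial ℂ) _

/-- the Krull dimension of `ℂ[x,y,z]/I` equals `1`; in particular the
ramification locus of `f₁` (the zero set of the `3×3` minors of its Jacobian matrix)
has codimension `2` in `ℂ³`. -/
theorem ramification_locus_f1_dim_one :
    ringKrullDim (MvPolynomial (Fin 3) ℂ ⧸ I) = 1 := by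
  exact le_antisymm ringKrullDim_quotient_I_le_one one_le_ringKrullDim_quotient_I
end

section
/- Let φ : ℂ[X,Y,Z,W] → ℂ[x,y,z] be the ℂ-algebra homomorphism sending X ↦ y²+xz, Y ↦ x⁵+yz+xy², Z ↦ x⁶+y³+z², W ↦ x⁷+x⁴z+xz²+y²z (the components of f₁). Then the kernel of φ is a nonzero principal prime ideal of ℂ[X,Y,Z,W]; in particular the image of f₁ is a hypersurface in ℂ⁴ defined by a single irreducible equation h. -/
open MvPolynomial

/-- The pullback homomorphism `φ = f₁* : ℂ[X,Y,Z,W] → ℂ[x,y,z]` of the map-germ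
`f₁(x,y,z) = (y²+xz, x⁵+yz+xy², x⁶+y³+z², x⁷+x⁴z+xz²+y²z)`
(with `x = X 0`, `y = X 1`, `z = X 2` in the source ring). -/
noncomputable def φ : MvPolynomial (Fin 4) ℂ →ₐ[ℂ] MvPolynomial (Fin 3) ℂ :=
  aeval
    ![X 1 ^ 2 + X 0 * X 2,
      X 0 ^ 5 + X 1 * X 2 + X 0 * X 1 ^ 2,
      X 0 ^ 6 + X 1 ^ 3 + X 2 ^ 2,
      X 0 ^ 7 + X 0 ^ 4 * X 2 + X 0 * X 2 ^ 2 + X 1 ^ 2 * X 2]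

namespace MvPolynomial

section Jacobian

variable {σ τ R : Type*} [CommSemiring R]

lemma totalDegree_pderiv_lt {p : MvPolynomial σ R} {i : σ} (h : pderiv i p ≠ 0) :
    (pderiv i p).totalDegree < p.totalDegree := by
  obtain ⟨m, hm, hdeg⟩ := Finset.exists_mem_eq_sup _ (support_nonempty.mpr h)
    fun s : σ →₀ ℕ => s.sum fun _ e => e
  have hm' : m + Finsupp.single i 1 ∈ p.support := by
    rw [mem_support_iff, coeff_pderiv] at hm
    exact mem_support_iff.mpr (left_ne_zero_of_mul hm)
  have hle := le_totalDegree hm'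
  rw [Finsupp.sum_add_index' (by simp) (by simp), Finsupp.sum_single_index rfl] at hle
  rw [totalDegree, hdeg]
  omega

lemma eq_C_of_forall_pderiv_eq_zero [NoZeroDivisors R] [CharZero R] {p : MvPolynomial σ R}
    (h : ∀ i, pderiv i p = 0) : p = C (coeff 0 p) := by
  classical
  ext m
  rw [coeff_C]
  split_ifs with hm
  · rw [hm]
  · obtain ⟨i, hi⟩ := Finsupp.ne_iff.mp (Ne.symm hm)
    have hle : Finsupp.single i 1 ≤ m := by
      rw [Finsupp.single_le_iff]
      exact Nat.one_le_iff_ne_zero.mpr hi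
    have hc := congrArg (coeff (m - Finsupp.single i 1)) (h i)
    rw [coeff_pderiv, tsub_add_cancel_of_le hle, coeff_zero, mul_eq_zero] at hc
    exact hc.resolve_right (Nat.cast_add_one_ne_zero _)

lemma pderiv_aeval [Fintype σ] (f : σ → MvPolynomial τ R) (j : τ) (p : MvPolynomial σ R) :
    pderiv j (aeval f p) = ∑ i, aeval f (pderiv i p) * pderiv j (f i) := by
  classical
  induction p using MvPolynomial.induction_on with
  | C a => simp [algebraMap_eq]
  | add p q hp hq => simp only [map_add, hp, hq, add_mul, Finset.sum_add_distrib]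
  | mul_X p k hp =>
    simp only [map_mul, aeval_X, pderiv_mul, hp, map_add, add_mul, Finset.sum_add_distrib,
      pderiv_X, Finset.sum_mul]
    congr 1
    · exact Finset.sum_congr rfl fun i _ => by ring
    · rw [Finset.sum_eq_single k]
      · simp
      · intro i _ hi
        simp [Pi.single_eq_of_ne hi.symm]
      · simp

/-- The Jacobian criterion for algebraic independence in characteristic zero. -/
theorem algebraicIndependent_of_det_jacobian_ne_zero {K : Type*} [Field K] [CharZero K]
    [Fintype σ] [DecidableEq σ] {f : σ → MvPolynomial σ K}
    (h : (Matrix.of fun i j => pderiv j (f i)).det ≠ 0) : AlgebraicIndependent K f := by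
  rw [algebraicIndependent_iff]
  intro p
  induction hn : p.totalDegree using Nat.strong_induction_on generalizing p with
  | _ n ih =>
    intro hp
    have hv : (fun i => aeval f (pderiv i p)) = 0 := by
      refine Matrix.eq_zero_of_vecMul_eq_zero h ?_
      ext1 j
      have hj := pderiv_aeval f j p
      rw [hp, map_zero] at hj
      exact hj.symm
    have hz : ∀ i, pderiv i p = 0 := fun i => by
      by_contra hi
      exact hi (ih _ (hn ▸ totalDegree_pderiv_lt hi) _ rfl (congrFun hv i))
    rw [eq_C_of_forall_pderiv_eq_zero hz] at hp ⊢
    rw [aeval_C, algebraMap_eq, C_eq_zero] at hp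
    rw [hp, C_0]

end Jacobian

lemma finSuccEquiv_rename_succ {R : Type*} [CommSemiring R] {n : ℕ} (p : MvPolynomial (Fin n) R) :
    finSuccEquiv R n (rename Fin.succ p) = Polynomial.C p := by
  rw [finSuccEquiv_apply, coe_eval₂Hom, eval₂_rename]
  induction p using MvPolynomial.induction_on <;> simp_all

end MvPolynomial

namespace Polynomial

attribute [local instance] Polynomial.algebra Polynomial.isLocalization in
/-- A prime of `A[X]` that meets the domain `A` only in zero has height at most one. -/
lemma height_le_one_of_comap_C_eq_bot {A : Type*} [CommRing A] [IsDomain A]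
    (P : Ideal (Polynomial A)) [P.IsPrime] (h : P.comap C = ⊥) : P.height ≤ 1 := by
  let K := FractionRing A
  let S : Submonoid (Polynomial A) := (nonZeroDivisors A).map (C : A →+* Polynomial A)
  have disj : Disjoint (S : Set (Polynomial A)) P := by
    refine Set.disjoint_left.mpr ?_
    rintro _ ⟨a, ha, rfl⟩ haP
    have : a ∈ P.comap C := haP
    rw [h, Ideal.mem_bot] at this
    exact nonZeroDivisors.ne_zero ha this
  have hP : (P.map (algebraMap (Polynomial A) (Polynomial K))).IsPrime :=
    IsLocalization.isPrime_of_isPrime_disjoint S _ P ‹_› disj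
  rw [← IsLocalization.height_map_of_disjoint (S := Polynomial K) S P disj]
  have hd : ringKrullDim (Polynomial K) = 1 := by
    rw [ringKrullDim_of_isNoetherianRing, ringKrullDim_eq_zero_of_field, zero_add]
  have := Ideal.height_le_ringKrullDim_of_ne_top hP.ne_top
  rw [hd] at this
  exact_mod_cast this

end Polynomial

/-- The last three components of `f₁` are algebraically independent. -/
lemma algebraicIndependent_f1_tail :
    AlgebraicIndependent ℂ (fun i : Fin 3 => φ (X i.succ)) := by
  refine algebraicIndependent_of_det_jacobian_ne_zero fun h => ?_
  have h' := congrArg (eval ![0, 1, 1]) h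
  simp [φ, Matrix.det_fin_three, pderiv_X] at h'
  norm_num at h'

lemma ker_f1_pullback_ne_bot : RingHom.ker φ ≠ ⊥ := by
  intro h
  have := trdeg_le_of_injective φ ((RingHom.injective_iff_ker_eq_bot φ).mpr h)
  rw [MvPolynomial.trdeg_of_isDomain, MvPolynomial.trdeg_of_isDomain] at this
  norm_num at this

lemma height_ker_f1_pullback_le_one : (RingHom.ker φ).height ≤ 1 := by
  let e := (finSuccEquiv ℂ 3).toRingEquiv
  have : (RingHom.ker φ).IsPrime := RingHom.ker_isPrime φ
  rw [← e.symm.height_comap]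
  refine Polynomial.height_le_one_of_comap_C_eq_bot _ ?_
  rw [eq_bot_iff]
  intro p hp
  have he : e.symm (Polynomial.C p) = rename Fin.succ p := by
    rw [RingEquiv.symm_apply_eq]
    exact (finSuccEquiv_rename_succ p).symm
  have hp' : φ (e.symm (Polynomial.C p)) = 0 := hp
  rw [he] at hp'
  refine (algebraicIndependent_iff.mp algebraicIndependent_f1_tail) p ?_
  rw [← hp', ← AlgHom.comp_apply]
  congr 1
  ext i : 1
  simp

/-- the kernel of `φ` is a nonzero principal prime ideal of `ℂ[X,Y,Z,W]`;
in particular the image of `f₁` is a hypersurface in `ℂ⁴` defined by a single irreducible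
equation `h`. -/
theorem ker_f1_pullback_principal_prime :
    RingHom.ker φ ≠ ⊥ ∧ (RingHom.ker φ).IsPrime ∧
      (RingHom.ker φ).IsPrincipal := by
  have hprime : (RingHom.ker φ).IsPrime := RingHom.ker_isPrime φ
  refine ⟨ker_f1_pullback_ne_bot, hprime, ?_⟩
  refine UniqueFactorizationMonoid.isPrincipal_of_height_eq_one
    (le_antisymm height_ker_f1_pullback_le_one ?_)
  rw [Order.one_le_iff_pos, pos_iff_ne_zero]
  exact fun h => ker_f1_pullback_ne_bot (Ideal.height_eq_zero_iff_eq_bot.mp h)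
end

section
/- Let M₂ be the 4×3 Jacobian matrix over ℂ[x,y,z] of the map f₂(x,y,z) = (y²+xz, x⁵+yz+xy², x⁶+y³+z², x⁹+x⁶z+z³+y³z), i.e., the matrix of partial derivatives (∂(f₂)_i/∂x_j), and let I₂ ⊆ ℂ[x,y,z] be the ideal generated by all 3×3 minors of M₂. Then the Krull dimension of ℂ[x,y,z]/I₂ equals 1; in particular the ramification locus of f₂ has codimension 2 in ℂ³. -/
open MvPolynomial

/-- The four components of the map-germ
`f₂(x,y,z) = (y²+xz, x⁵+yz+xy², x⁶+y³+z², x⁹+x⁶z+z³+y³z)`,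
as polynomials in `ℂ[x,y,z]` with `x = X 0`, `y = X 1`, `z = X 2`. -/
noncomputable def f2 : Fin 4 → MvPolynomial (Fin 3) ℂ :=
  ![X 1 ^ 2 + X 0 * X 2,
    X 0 ^ 5 + X 1 * X 2 + X 0 * X 1 ^ 2,
    X 0 ^ 6 + X 1 ^ 3 + X 2 ^ 2,
    X 0 ^ 9 + X 0 ^ 6 * X 2 + X 2 ^ 3 + X 1 ^ 3 * X 2]

/-- The `4×3` Jacobian matrix of `f₂`: the matrix of partial derivatives
`∂(f₂)ⱼ/∂xᵢ` over `ℂ[x,y,z]`. -/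
noncomputable def M2 : Matrix (Fin 4) (Fin 3) (MvPolynomial (Fin 3) ℂ) :=
  Matrix.of fun (j : Fin 4) (i : Fin 3) => pderiv i (f2 j)

/-- The ideal of `ℂ[x,y,z]` generated by all `3×3` minors of `M2`. -/
noncomputable def I2 : Ideal (MvPolynomial (Fin 3) ℂ) :=
  Ideal.span { p | ∃ r : Fin 3 → Fin 4, Function.Injective r ∧
    p = (M2.submatrix r id).det }

section Elimination

variable {A : Type*} [CommRing A] {x y z : A}

/-- The vanishing of the minors of the Jacobian matrix of `f2` on the rows `0, 1, 2` and
`0, 1, 3`. -/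
structure MinorsVanish (x y z : A) : Prop where
  first : 2 * z ^ 3 + 4 * x * y * z ^ 2 + 27 * x ^ 5 * y ^ 2 + 3 * x * y ^ 4 - 7 * y ^ 3 * z
    - 6 * x ^ 6 * z - 12 * x ^ 7 * y - 20 * x ^ 4 * y * z = 0
  second : -5 * x ^ 6 * z ^ 2 + 3 * z ^ 4 - 8 * y ^ 3 * z ^ 2 - 10 * x ^ 7 * y * z +
    6 * x * y * z ^ 3 + 5 * x * y ^ 4 * z + 18 * x ^ 8 * y ^ 2 + 27 * x ^ 5 * y ^ 2 * z
    - 9 * x ^ 9 * z - 28 * x ^ 10 * y - 30 * x ^ 4 * y * z ^ 2 - 10 * x ^ 4 * y ^ 4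
    - 2 * x ^ 6 * y ^ 3 - 2 * y ^ 6 = 0

/-- The terms other than `162 * y ^ 18` of an element of the elimination ideal of the two
minors. -/
def eliminantTail (x y : A) : A :=
  -241 * x ^ 2 * y ^ 17 + 1527 * x ^ 4 * y ^ 16 - 2996 * x ^ 6 * y ^ 15 +
    4301 * x ^ 8 * y ^ 14 - 8054 * x ^ 10 * y ^ 13 - 222 * x ^ 12 * y ^ 12 +
    9731 * x ^ 14 * y ^ 11 - 65343 * x ^ 16 * y ^ 10 + 106252 * x ^ 18 * y ^ 9
    - 211489 * x ^ 20 * y ^ 8 + 215212 * x ^ 22 * y ^ 7 - 258330 * x ^ 24 * y ^ 6 +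
    174200 * x ^ 26 * y ^ 5 - 142788 * x ^ 28 * y ^ 4 + 32464 * x ^ 30 * y ^ 3
    - 16120 * x ^ 32 * y ^ 2 - 1760 * x ^ 34 * y

lemma map_eliminantTail {B : Type*} [CommRing B] (f : A →+* B) (x y : A) :
    f (eliminantTail x y) = eliminantTail (f x) (f y) := by
  simp [eliminantTail, map_ofNat]

lemma MinorsVanish.eliminant_eq_zero (h : MinorsVanish x y z) :
    3 * (162 * y ^ 18 + eliminantTail x y) = 0 := by
  unfold eliminantTail
  linear_combination
    (-792 * x ^ 27 + 1920 * x ^ 25 * y - 8428 * x ^ 23 * y ^ 2 + 8928 * x ^ 21 * y ^ 3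
      - 12182 * x ^ 19 * y ^ 4 + 7424 * x ^ 17 * y ^ 5 - 9003 * x ^ 15 * y ^ 6 +
      4708 * x ^ 13 * y ^ 7 - 4280 * x ^ 11 * y ^ 8 + 1119 * x ^ 9 * y ^ 9
      - 514 * x ^ 7 * y ^ 10 - 485 * x ^ 5 * y ^ 11 - 3 * x ^ 3 * y ^ 12 - 145 * x * y ^ 13
      - 440 * x ^ 24 * z - 2000 * x ^ 22 * y * z - 1560 * x ^ 20 * y ^ 2 * z
      - 8816 * x ^ 18 * y ^ 3 * z + 3682 * x ^ 16 * y ^ 4 * z - 13746 * x ^ 14 * y ^ 5 * z +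
      8174 * x ^ 12 * y ^ 6 * z - 9067 * x ^ 10 * y ^ 7 * z + 4422 * x ^ 8 * y ^ 8 * z
      - 2323 * x ^ 6 * y ^ 9 * z + 1370 * x ^ 4 * y ^ 10 * z - 231 * x ^ 2 * y ^ 11 * z +
      252 * y ^ 12 * z - 720 * x ^ 19 * y * z ^ 2 - 2352 * x ^ 17 * y ^ 2 * z ^ 2
      - 432 * x ^ 15 * y ^ 3 * z ^ 2 - 1464 * x ^ 13 * y ^ 4 * z ^ 2
      - 1332 * x ^ 11 * y ^ 5 * z ^ 2 - 1872 * x ^ 9 * y ^ 6 * z ^ 2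
      - 360 * x ^ 7 * y ^ 7 * z ^ 2 - 1851 * x ^ 5 * y ^ 8 * z ^ 2 - 36 * x ^ 3 * y ^ 9 * z ^ 2
      - 417 * x * y ^ 10 * z ^ 2 + 264 * x ^ 18 * z ^ 3 - 960 * x ^ 16 * y * z ^ 3 +
      1368 * x ^ 14 * y ^ 2 * z ^ 3 - 1728 * x ^ 12 * y ^ 3 * z ^ 3 +
      1026 * x ^ 10 * y ^ 4 * z ^ 3 - 648 * x ^ 8 * y ^ 5 * z ^ 3 - 174 * x ^ 6 * y ^ 6 * z ^ 3
      - 300 * x ^ 4 * y ^ 7 * z ^ 3 - 18 * x ^ 2 * y ^ 8 * z ^ 3 - 135 * y ^ 9 * z ^ 3) * h.first +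
    (528 * x ^ 24 + 480 * x ^ 22 * y + 2256 * x ^ 20 * y ^ 2 + 4488 * x ^ 18 * y ^ 3
      - 2076 * x ^ 16 * y ^ 4 + 9348 * x ^ 14 * y ^ 5 - 6564 * x ^ 12 * y ^ 6 +
      6348 * x ^ 10 * y ^ 7 - 3324 * x ^ 8 * y ^ 8 + 1332 * x ^ 6 * y ^ 9
      - 1080 * x ^ 4 * y ^ 10 + 144 * x ^ 2 * y ^ 11 - 243 * y ^ 12 + 480 * x ^ 19 * y * z +
      1568 * x ^ 17 * y ^ 2 * z + 288 * x ^ 15 * y ^ 3 * z + 976 * x ^ 13 * y ^ 4 * z +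
      888 * x ^ 11 * y ^ 5 * z + 1248 * x ^ 9 * y ^ 6 * z + 240 * x ^ 7 * y ^ 7 * z +
      1234 * x ^ 5 * y ^ 8 * z + 24 * x ^ 3 * y ^ 9 * z + 278 * x * y ^ 10 * z
      - 176 * x ^ 18 * z ^ 2 + 640 * x ^ 16 * y * z ^ 2 - 912 * x ^ 14 * y ^ 2 * z ^ 2 +
      1152 * x ^ 12 * y ^ 3 * z ^ 2 - 684 * x ^ 10 * y ^ 4 * z ^ 2 + 432 * x ^ 8 * y ^ 5 * z ^ 2
      + 116 * x ^ 6 * y ^ 6 * z ^ 2 + 200 * x ^ 4 * y ^ 7 * z ^ 2 + 12 * x ^ 2 * y ^ 8 * z ^ 2 +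
      90 * y ^ 9 * z ^ 2) * h.second

end Elimination

lemma degree_eliminantTail_lt (R : Type*) [CommRing R] (a : R) :
    (eliminantTail (Polynomial.C a) Polynomial.X).degree < (18 : ℕ) := by
  refine lt_of_le_of_lt (b := ((17 : ℕ) : WithBot ℕ)) ?_ (by norm_num)
  unfold eliminantTail
  compute_degree
  rfl

lemma MinorsVanish.isIntegral_snd {A : Type*} [CommRing A] [Algebra (Polynomial ℂ) A] {y z : A}
    (h : MinorsVanish (algebraMap (Polynomial ℂ) A Polynomial.X) y z) :
    IsIntegral (Polynomial ℂ) y := by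
  let c : A := algebraMap (Polynomial ℂ) A (.C 486⁻¹)
  have hc : c * 486 = 1 := by
    rw [← map_ofNat (algebraMap (Polynomial ℂ) A) 486, ← map_mul, ← map_ofNat Polynomial.C 486,
      ← map_mul]
    norm_num
  refine ⟨.X ^ 18 + .C (.C 486⁻¹) * (3 * eliminantTail (.C .X) .X),
    Polynomial.monic_X_pow_add ?_, ?_⟩
  · rw [← map_ofNat Polynomial.C 3, ← mul_assoc, ← map_mul, ← Polynomial.smul_eq_C_mul]
    exact (Polynomial.degree_smul_le _ _).trans_lt (degree_eliminantTail_lt _ _)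
  · rw [← Polynomial.coe_eval₂RingHom]
    simp only [map_add, map_mul, map_pow, map_ofNat, map_eliminantTail,
      Polynomial.coe_eval₂RingHom, Polynomial.eval₂_X, Polynomial.eval₂_C]
    linear_combination c * h.eliminant_eq_zero - y ^ 18 * hc

lemma MinorsVanish.isIntegral_thd {A : Type*} [CommRing A] [Algebra (Polynomial ℂ) A] {y z : A}
    (h : MinorsVanish (algebraMap (Polynomial ℂ) A Polynomial.X) y z) :
    IsIntegral (Polynomial ℂ) z := by
  let B := integralClosure (Polynomial ℂ) A
  let x' : B := algebraMap (Polynomial ℂ) B Polynomial.X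
  let y' : B := ⟨y, h.isIntegral_snd⟩
  let c : B := algebraMap (Polynomial ℂ) B (.C 2⁻¹)
  have hc : algebraMap B A c * 2 = 1 := by
    rw [← map_ofNat (algebraMap (Polynomial ℂ) A) 2, ← IsScalarTower.algebraMap_apply,
      ← map_mul, ← map_ofNat Polynomial.C 2, ← map_mul]
    norm_num
  have hx : algebraMap B A x' = algebraMap (Polynomial ℂ) A Polynomial.X := rfl
  have hy : algebraMap B A y' = y := rfl
  refine isIntegral_trans (A := B) z ⟨.X ^ 3 +
    (.C (c * (4 * x' * y')) * .X ^ 2 + .C (c * (-7 * y' ^ 3 - 6 * x' ^ 6 - 20 * x' ^ 4 * y')) * .X +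
      .C (c * (27 * x' ^ 5 * y' ^ 2 + 3 * x' * y' ^ 4 - 12 * x' ^ 7 * y'))),
    Polynomial.monic_X_pow_add (lt_of_le_of_lt Polynomial.degree_quadratic_le (by norm_num)), ?_⟩
  rw [← Polynomial.coe_eval₂RingHom]
  simp only [map_add, map_sub, map_mul, map_neg, map_pow, map_ofNat,
    Polynomial.coe_eval₂RingHom, Polynomial.eval₂_X, Polynomial.eval₂_C, hx, hy]
  linear_combination algebraMap B A c * h.first - z ^ 3 * hc

lemma ringKrullDim_polynomial_complex : ringKrullDim (Polynomial ℂ) = 1 := by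
  simp

lemma minorsVanish_mk_I2 : MinorsVanish (Ideal.Quotient.mk I2 (X 0))
    (Ideal.Quotient.mk I2 (X 1)) (Ideal.Quotient.mk I2 (X 2)) := by
  constructor
  · have h : (M2.submatrix ![0, 1, 2] id).det ∈ I2 := Ideal.subset_span ⟨_, by decide, rfl⟩
    rw [← Ideal.Quotient.eq_zero_iff_mem, Matrix.det_fin_three] at h
    simp [M2, f2, pderiv_X, map_ofNat] at h
    linear_combination h
  · have h : (M2.submatrix ![0, 1, 3] id).det ∈ I2 := Ideal.subset_span ⟨_, by decide, rfl⟩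
    rw [← Ideal.Quotient.eq_zero_iff_mem, Matrix.det_fin_three] at h
    simp [M2, f2, pderiv_X, map_ofNat] at h
    linear_combination h

lemma ringKrullDim_quotient_I2_le : ringKrullDim (MvPolynomial (Fin 3) ℂ ⧸ I2) ≤ 1 := by
  let φ : Polynomial ℂ →ₐ[ℂ] MvPolynomial (Fin 3) ℂ ⧸ I2 :=
    Polynomial.aeval (Ideal.Quotient.mk I2 (X 0))
  algebraize [φ.toRingHom]
  have hx : algebraMap (Polynomial ℂ) (MvPolynomial (Fin 3) ℂ ⧸ I2) Polynomial.X =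
      Ideal.Quotient.mk I2 (X 0) := Polynomial.aeval_X _
  have h := minorsVanish_mk_I2
  rw [← hx] at h
  have : Algebra.IsIntegral (Polynomial ℂ) (MvPolynomial (Fin 3) ℂ ⧸ I2) := by
    refine ⟨fun a => ?_⟩
    obtain ⟨p, rfl⟩ := Ideal.Quotient.mk_surjective a
    induction p using MvPolynomial.induction_on with
    | C r =>
      have : Ideal.Quotient.mk I2 (C r) = algebraMap (Polynomial ℂ) _ (.C r) :=
        (φ.commutes r).symm
      exact this ▸ isIntegral_algebraMap
    | add p q hp hq => exact map_add (Ideal.Quotient.mk I2) p q ▸ hp.add hq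
    | mul_X p i hp =>
      rw [map_mul]
      refine hp.mul ?_
      fin_cases i
      · exact hx ▸ isIntegral_algebraMap
      · exact h.isIntegral_snd
      · exact h.isIntegral_thd
  exact (ringKrullDim_le_of_isIntegral (Polynomial ℂ) _).trans_eq ringKrullDim_polynomial_complex

/-- The `x`-axis lies in the ramification locus. -/
lemma one_le_ringKrullDim_quotient_I2 : 1 ≤ ringKrullDim (MvPolynomial (Fin 3) ℂ ⧸ I2) := by
  let ψ : MvPolynomial (Fin 3) ℂ →ₐ[ℂ] Polynomial ℂ := aeval ![Polynomial.X, 0, 0]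
  have hψ : ∀ a ∈ I2, ψ.toRingHom a = 0 := by
    refine fun a ha => (Ideal.span_le (I := RingHom.ker ψ.toRingHom)).mpr ?_ ha
    rintro _ ⟨r, -, rfl⟩
    rw [SetLike.mem_coe, RingHom.mem_ker, RingHom.map_det]
    refine Matrix.det_eq_zero_of_column_eq_zero 1 fun i => ?_
    have key : ∀ j, ψ (pderiv 1 (f2 j)) = 0 := by
      intro j
      fin_cases j <;> simp [f2, ψ, pderiv_X]
    exact key (r i)
  rw [← ringKrullDim_polynomial_complex]
  refine ringKrullDim_le_of_surjective (Ideal.Quotient.lift I2 ψ.toRingHom hψ)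
    (Ideal.Quotient.lift_surjective_of_surjective _ _ fun p => ⟨Polynomial.aeval (X 0) p, ?_⟩)
  change ψ (Polynomial.aeval (X 0) p) = p
  rw [← Polynomial.aeval_algHom_apply]
  simp [ψ]

/-- the Krull dimension of `ℂ[x,y,z]/I2` equals `1`; in particular the
ramification locus of `f₂` has codimension `2` in `ℂ³`. -/
theorem ramification_locus_f2_dim_one :
    ringKrullDim (MvPolynomial (Fin 3) ℂ ⧸ I2) = 1 := by
  exact le_antisymm ringKrullDim_quotient_I2_le one_le_ringKrullDim_quotient_I2
end

section
/- Let M₃ be the 4×3 Jacobian matrix over ℂ[x,y,z] of the map f₃(x,y,z) = (y²+xz, x⁵+yz+xy², x⁶+y³+z², x¹³+x¹⁰z+xz⁴+y⁵z), i.e., the matrix of partial derivatives (∂(f₃)_i/∂x_j), and let I₃ ⊆ ℂ[x,y,z] be the ideal generated by all 3×3 minors of M₃. Then the Krull dimension of ℂ[x,y,z]/I₃ equals 1; in particular the ramification locus of f₃ has codimension 2 in ℂ³. -/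
open MvPolynomial

/-- The four components of the map-germ
`f₃(x,y,z) = (y²+xz, x⁵+yz+xy², x⁶+y³+z², x¹³+x¹⁰z+xz⁴+y⁵z)`,
as polynomials in `ℂ[x,y,z]` with `x = X 0`, `y = X 1`, `z = X 2`. -/
noncomputable def f3 : Fin 4 → MvPolynomial (Fin 3) ℂ :=
  ![X 1 ^ 2 + X 0 * X 2,
    X 0 ^ 5 + X 1 * X 2 + X 0 * X 1 ^ 2,
    X 0 ^ 6 + X 1 ^ 3 + X 2 ^ 2,
    X 0 ^ 13 + X 0 ^ 10 * X 2 + X 0 * X 2 ^ 4 + X 1 ^ 5 * X 2]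

/-- The `4×3` Jacobian matrix of `f₃`: the matrix of partial derivatives
`∂(f₃)ⱼ/∂xᵢ` over `ℂ[x,y,z]`. -/
noncomputable def M3 : Matrix (Fin 4) (Fin 3) (MvPolynomial (Fin 3) ℂ) :=
  Matrix.of fun (j : Fin 4) (i : Fin 3) => pderiv i (f3 j)

/-- The ideal of `ℂ[x,y,z]` generated by all `3×3` minors of `M3`. -/
noncomputable def I3 : Ideal (MvPolynomial (Fin 3) ℂ) :=
  Ideal.span { p | ∃ r : Fin 3 → Fin 4, Function.Injective r ∧
    p = (M3.submatrix r id).det }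

/-- Two polynomials, the first with unit leading coefficient, have no common factor as soon as
their images under some ring hom on the coefficients are coprime. -/
theorem isRelPrime_of_isCoprime_map {S K : Type*} [CommRing S] [IsDomain S] [CommRing K]
    [IsDomain K] (ρ : S →+* K) {p q : Polynomial S} (hp : IsUnit p.leadingCoeff)
    (h : IsCoprime (p.map ρ) (q.map ρ)) : IsRelPrime p q := by
  intro d hdp hdq
  have hlead : IsUnit d.leadingCoeff :=
    isUnit_of_dvd_unit (Polynomial.leadingCoeff_dvd_leadingCoeff hdp) hp
  have hmap : IsUnit (d.map ρ) :=
    h.isRelPrime (Polynomial.map_dvd ρ hdp) (Polynomial.map_dvd ρ hdq)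
  have hdeg : d.natDegree = 0 := by
    rw [← Polynomial.natDegree_map_of_leadingCoeff_ne_zero ρ (hlead.map ρ).ne_zero]
    exact Polynomial.natDegree_eq_zero_of_isUnit hmap
  rw [Polynomial.eq_C_of_natDegree_eq_zero hdeg, Polynomial.isUnit_C]
  rwa [Polynomial.leadingCoeff, hdeg] at hlead

/-- Killing two elements without common factor drops the Krull dimension by at least two. -/
theorem ringKrullDim_quotient_add_two_le_of_isRelPrime {R : Type*} [CommRing R] [IsDomain R]
    [UniqueFactorizationMonoid R] {I : Ideal R} {a b : R} (haI : a ∈ I) (hbI : b ∈ I)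
    (ha : a ≠ 0) (hab : IsRelPrime a b) : ringKrullDim (R ⧸ I) + 1 + 1 ≤ ringKrullDim R := by
  have hb : Ideal.Quotient.mk (Ideal.span {a}) b ∈ nonZeroDivisors (R ⧸ Ideal.span {a}) := by
    rw [mem_nonZeroDivisors_iff_right]
    intro c hc
    obtain ⟨c, rfl⟩ := Ideal.Quotient.mk_surjective c
    rw [← map_mul, Ideal.Quotient.eq_zero_iff_mem, Ideal.mem_span_singleton] at hc
    rw [Ideal.Quotient.eq_zero_iff_mem, Ideal.mem_span_singleton]
    exact hab.dvd_of_dvd_mul_right hc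
  have haI' : Ideal.span {a} ≤ I := (Ideal.span_singleton_le_iff_mem I).2 haI
  have hle : ringKrullDim (R ⧸ I) ≤
      ringKrullDim ((R ⧸ Ideal.span {a}) ⧸ Ideal.span {Ideal.Quotient.mk (Ideal.span {a}) b}) := by
    refine ringKrullDim_le_of_surjective (Ideal.Quotient.lift _ (Ideal.Quotient.factor haI') ?_)
      (Ideal.Quotient.lift_surjective_of_surjective _ _ (Ideal.Quotient.factor_surjective haI'))
    intro x hx
    rw [← RingHom.mem_ker]
    refine (Ideal.span_singleton_le_iff_mem _).2 ?_ hx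
    simpa [RingHom.mem_ker, Ideal.Quotient.eq_zero_iff_mem] using hbI
  calc ringKrullDim (R ⧸ I) + 1 + 1
      ≤ ringKrullDim (R ⧸ Ideal.span {a}) + 1 := by
        gcongr
        exact (add_le_add_left hle 1).trans (ringKrullDim_quotient_succ_le_of_nonZeroDivisor hb)
    _ ≤ ringKrullDim R :=
        ringKrullDim_quotient_succ_le_of_nonZeroDivisor (mem_nonZeroDivisors_of_ne_zero ha)

theorem det_submatrix_mem_I3 (r : Fin 3 → Fin 4) (hr : Function.Injective r) :
    (M3.submatrix r id).det ∈ I3 :=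
  Ideal.subset_span ⟨r, hr, rfl⟩

/-- `ℂ[x,y,z]` as polynomials in `z` over `ℂ[y,x]`. -/
noncomputable def polynomialInZ :
    MvPolynomial (Fin 3) ℂ ≃ₐ[ℂ] Polynomial (MvPolynomial (Fin 2) ℂ) :=
  (renameEquiv ℂ Fin.revPerm).trans (finSuccEquiv ℂ 2)

theorem polynomialInZ_X_zero : polynomialInZ (X 0) = Polynomial.C (X 1) := by
  simpa [polynomialInZ] using finSuccEquiv_X_succ (R := ℂ) (j := (1 : Fin 2))

theorem polynomialInZ_X_one : polynomialInZ (X 1) = Polynomial.C (X 0) := by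
  simpa [polynomialInZ] using finSuccEquiv_X_succ (R := ℂ) (j := (0 : Fin 2))

theorem polynomialInZ_X_two : polynomialInZ (X 2) = Polynomial.X := by
  simpa [polynomialInZ] using finSuccEquiv_X_zero (R := ℂ) (n := 2)

theorem M3_eq : M3 =
    !![X 2, 2 * X 1, X 0;
      5 * X 0 ^ 4 + X 1 ^ 2, X 2 + 2 * X 0 * X 1, X 1;
      6 * X 0 ^ 5, 3 * X 1 ^ 2, 2 * X 2;
      13 * X 0 ^ 12 + 10 * X 0 ^ 9 * X 2 + X 2 ^ 4, 5 * X 1 ^ 4 * X 2,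
        X 0 ^ 10 + 4 * X 0 * X 2 ^ 3 + X 1 ^ 5] := by
  ext1 j i
  fin_cases j <;> fin_cases i <;> simp [M3, f3, pderiv_X] <;> ring

theorem polynomialInZ_det_012 : polynomialInZ (M3.submatrix ![0, 1, 2] id).det =
    Polynomial.C 2 * Polynomial.X ^ 3 + Polynomial.C (4 * X 1 * X 0) * Polynomial.X ^ 2 +
      Polynomial.C (-7 * X 0 ^ 3 - 20 * X 1 ^ 4 * X 0 - 6 * X 1 ^ 6) * Polynomial.X +
      Polynomial.C (27 * X 1 ^ 5 * X 0 ^ 2 + 3 * X 1 * X 0 ^ 4 - 12 * X 1 ^ 7 * X 0) := by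
  rw [Matrix.det_fin_three]
  simp [M3_eq, map_ofNat, polynomialInZ_X_zero, polynomialInZ_X_one,
    polynomialInZ_X_two]
  ring

theorem leadingCoeff_polynomialInZ_det_012 :
    (polynomialInZ (M3.submatrix ![0, 1, 2] id).det).leadingCoeff = 2 := by
  rw [polynomialInZ_det_012, Polynomial.leadingCoeff_cubic two_ne_zero]

theorem det_012_ne_zero : (M3.submatrix ![0, 1, 2] id).det ≠ 0 := by
  intro h
  have h₂ := leadingCoeff_polynomialInZ_det_012
  rw [h, map_zero, Polynomial.leadingCoeff_zero] at h₂
  exact two_ne_zero h₂.symm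

theorem isRelPrime_det_012_det_013 :
    IsRelPrime (M3.submatrix ![0, 1, 2] id).det (M3.submatrix ![0, 1, 3] id).det := by
  suffices h : IsRelPrime (polynomialInZ (M3.submatrix ![0, 1, 2] id).det)
      (polynomialInZ (M3.submatrix ![0, 1, 3] id).det) from fun d h₁ h₂ =>
    (MulEquiv.isUnit_map polynomialInZ).1 (h (map_dvd polynomialInZ h₁) (map_dvd polynomialInZ h₂))
  have hunit : IsUnit (2 : MvPolynomial (Fin 2) ℂ) := by
    rw [← map_ofNat (C : ℂ →+* MvPolynomial (Fin 2) ℂ) 2]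
    exact (IsUnit.mk0 (2 : ℂ) two_ne_zero).map _
  refine isRelPrime_of_isCoprime_map (eval ![1, 0])
    (leadingCoeff_polynomialInZ_det_012 ▸ hunit) ?_
  have hC : Polynomial.C (1 / 17 : ℂ) * 17 = 1 := by
    rw [← Polynomial.C_ofNat, ← Polynomial.C_mul]
    norm_num
  have hC' : Polynomial.C (1 / 34 : ℂ) * 2 = Polynomial.C (1 / 17 : ℂ) := by
    rw [← Polynomial.C_ofNat, ← Polynomial.C_mul]
    norm_num
  refine ⟨Polynomial.C (1 / 17) * (-Polynomial.X * (3 * Polynomial.X ^ 2 - 4)),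
    Polynomial.C (1 / 34) * (6 * Polynomial.X ^ 2 - 17), ?_⟩
  have h₁ : (polynomialInZ (M3.submatrix ![0, 1, 2] id).det).map (eval ![1, 0]) =
      (2 * Polynomial.X ^ 3 - 7 * Polynomial.X : Polynomial ℂ) := by
    rw [Matrix.det_fin_three]
    simp [M3_eq, map_ofNat, polynomialInZ_X_zero, polynomialInZ_X_one,
      polynomialInZ_X_two]
    ring
  have h₂ : (polynomialInZ (M3.submatrix ![0, 1, 3] id).det).map (eval ![1, 0]) =
      (2 * (Polynomial.X ^ 4 - 2 * Polynomial.X ^ 2 - 1) : Polynomial ℂ) := by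
    rw [Matrix.det_fin_three]
    simp [M3_eq, map_ofNat, polynomialInZ_X_zero, polynomialInZ_X_one,
      polynomialInZ_X_two]
    ring
  rw [h₁, h₂]
  linear_combination hC + (6 * Polynomial.X ^ 2 - 17) *
    (Polynomial.X ^ 4 - 2 * Polynomial.X ^ 2 - 1) * hC'

/-- The ramification locus contains the `x`-axis. -/
theorem one_le_ringKrullDim_quotient_I3 :
    1 ≤ ringKrullDim (MvPolynomial (Fin 3) ℂ ⧸ I3) := by
  let ψ : MvPolynomial (Fin 3) ℂ →ₐ[ℂ] Polynomial ℂ := aeval ![Polynomial.X, 0, 0]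
  have hψ : ∀ p ∈ I3, ψ.toRingHom p = 0 := by
    suffices I3 ≤ RingHom.ker ψ.toRingHom from fun p hp => this hp
    rw [I3, Ideal.span_le]
    rintro _ ⟨r, -, rfl⟩
    rw [SetLike.mem_coe, RingHom.mem_ker, RingHom.map_det]
    refine Matrix.det_eq_zero_of_column_eq_zero 1 fun i => ?_
    generalize hj : r i = j
    fin_cases j <;> simp [hj, M3_eq, ψ]
  have hsurj : Function.Surjective ψ.toRingHom := by
    intro p
    exact ⟨Polynomial.aeval (X 0) p, by
      simp [ψ, ← Polynomial.aeval_algHom_apply]⟩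
  have hdim : ringKrullDim (Polynomial ℂ) = 1 := by
    rw [Polynomial.ringKrullDim_of_isNoetherianRing, ringKrullDim_eq_zero_of_field, zero_add]
  rw [← hdim]
  exact ringKrullDim_le_of_surjective _ (Ideal.Quotient.lift_surjective_of_surjective I3 hψ hsurj)

/-- the Krull dimension of `ℂ[x,y,z]/I3` equals `1`; in particular the
ramification locus of `f₃` has codimension `2` in `ℂ³`. -/
theorem ramification_locus_f3_dim_one :
    ringKrullDim (MvPolynomial (Fin 3) ℂ ⧸ I3) = 1 := by
  refine le_antisymm ?_ one_le_ringKrullDim_quotient_I3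
  have h := ringKrullDim_quotient_add_two_le_of_isRelPrime
    (det_submatrix_mem_I3 ![0, 1, 2] (by decide)) (det_submatrix_mem_I3 ![0, 1, 3] (by decide))
    det_012_ne_zero isRelPrime_det_012_det_013
  have hdim : ringKrullDim (MvPolynomial (Fin 3) ℂ) = 1 + 1 + 1 := by
    rw [MvPolynomial.ringKrullDim_of_isNoetherianRing, ringKrullDim_eq_zero_of_field, zero_add,
      Nat.card_eq_fintype_card, Fintype.card_fin]
    norm_num
  rwa [hdim, ENat.WithBot.add_le_add_one_right_iff, ENat.WithBot.add_le_add_one_right_iff] at h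
end
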